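/- Let u, v : ℕ → ℝ and let S be a finite set of primes such that |u(p)·v(p)| ≤ 16 for every prime p ∉ S. Suppose ∑_{p ≤ x, p prime, p ∉ S} u(p)·v(p) = o(x/log x) as x → ∞ and liminf_{x→∞} (log x / x) · ∑_{p ≤ x, p prime, p ∉ S} u(p)²·v(p)² ≥ β for some β > 0. Then liminf_{x→∞} (log x / x) · #{p ≤ x : p prime and u(p)·v(p) < 0} ≥ β/512; in particular the set of primes p with u(p)·v(p) < 0 is infinite. -/

import Mathlib

open Filter Asymptotics

/-- The finite set of primes `p ≤ x` (for a real `x`). -/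
noncomputable def primesUpTo (x : ℝ) : Finset ℕ :=
  (Finset.Iic ⌊x⌋₊).filter Nat.Prime

/-- The sign-change argument: if `|u(p)·v(p)| ≤ 16` off a finite set `S` of primes,
`∑_{p ≤ x, p ∉ S} u(p)·v(p) = o(x/log x)`, and
`liminf (log x / x) · ∑_{p ≤ x, p ∉ S} u(p)²·v(p)² ≥ β > 0`, then
`liminf (log x / x) · #{p ≤ x : p prime, u(p)·v(p) < 0} ≥ β/512`; in particular the set
of primes `p` with `u(p)·v(p) < 0` is infinite. -/
theorem sign_change_liminf (u v : ℕ → ℝ) (S : Finset ℕ)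
    (hS : ∀ p ∈ S, Nat.Prime p)
    (hbound : ∀ p : ℕ, Nat.Prime p → p ∉ S → |u p * v p| ≤ 16)
    (hsmall : (fun x : ℝ =>
        ∑ p ∈ (primesUpTo x).filter (fun p => p ∉ S), u p * v p)
      =o[atTop] (fun x : ℝ => x / Real.log x))
    (β : ℝ) (hβ : 0 < β)
    (hbig : β ≤
      Filter.liminf
        (fun x : ℝ => (Real.log x / x) *
          ∑ p ∈ (primesUpTo x).filter (fun p => p ∉ S),
            (u p) ^ 2 * (v p) ^ 2)
        atTop) :
    (β / 512 ≤
      Filter.liminf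
        (fun x : ℝ => (Real.log x / x) *
          ((primesUpTo x).filter (fun p => u p * v p < 0)).card)
        atTop) ∧
    {p : ℕ | Nat.Prime p ∧ u p * v p < 0}.Infinite := by
  have key : ∀ c < β / 512, ∀ᶠ x : ℝ in atTop, c ≤ (Real.log x / x) *
          ((primesUpTo x).filter (fun p => u p * v p < 0)).card := by
    intro c hc
    have hδ : 0 < (β / 512 - c) := by linarith
    have h1 : ∀ᶠ x : ℝ in atTop, β - (β / 512 - c) < (Real.log x / x) *
          ∑ p ∈ (primesUpTo x).filter (fun p => p ∉ S), (u p) ^ 2 * (v p) ^ 2 := by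
      refine eventually_lt_of_lt_liminf (lt_of_lt_of_le (by linarith) hbig) ?_
      refine ⟨0, ?_⟩
      rw [eventually_map]
      filter_upwards [eventually_gt_atTop 1] with x hx
      have : 0 < Real.log x := Real.log_pos hx
      have : 0 ≤ ∑ p ∈ (primesUpTo x).filter (fun p => p ∉ S), (u p) ^ 2 * (v p) ^ 2 :=
        Finset.sum_nonneg fun p _ => by positivity
      show 0 ≤ _
      positivity
    filter_upwards [h1, hsmall.bound hδ, eventually_gt_atTop 1] with x hx1 hx2 hx
    have hl : 0 < Real.log x := Real.log_pos hx
    have hx0 : 0 < x := by linarith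
    have hr : 0 < Real.log x / x := by positivity
    have hsum : ∑ p ∈ (primesUpTo x).filter (fun p => p ∉ S),
          ((u p) ^ 2 * (v p) ^ 2 - 16 * (u p * v p)) ≤
        512 * (((primesUpTo x).filter (fun p => u p * v p < 0)).card : ℝ) := by
      have e1 : ∑ p ∈ (primesUpTo x).filter (fun p => p ∉ S),
          ((u p) ^ 2 * (v p) ^ 2 - 16 * (u p * v p)) ≤
          ∑ p ∈ (primesUpTo x).filter (fun p => p ∉ S),
            (if u p * v p < 0 then (512 : ℝ) else 0) := by
        refine Finset.sum_le_sum fun p hp => ?_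
        simp only [primesUpTo, Finset.mem_filter] at hp
        have hb := abs_le.mp (hbound p hp.1.2 hp.2)
        rw [← mul_pow]
        split_ifs with h
        · nlinarith
        · nlinarith
      have e2 : ∑ p ∈ (primesUpTo x).filter (fun p => p ∉ S),
            (if u p * v p < 0 then (512 : ℝ) else 0) ≤
          ∑ p ∈ primesUpTo x, (if u p * v p < 0 then (512 : ℝ) else 0) := by
        refine Finset.sum_le_sum_of_subset_of_nonneg (Finset.filter_subset _ _) ?_
        intro p _ _
        split_ifs <;> norm_num
      refine (e1.trans e2).trans (le_of_eq ?_)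
      rw [← Finset.sum_filter, Finset.sum_const, nsmul_eq_mul, mul_comm]
    rw [Finset.sum_sub_distrib, ← Finset.mul_sum] at hsum
    rw [Real.norm_eq_abs, Real.norm_of_nonneg (by positivity)] at hx2
    have h3 := mul_le_mul_of_nonneg_left ((le_abs_self _).trans hx2) hr.le
    have h4 : Real.log x / x * ((β / 512 - c) * (x / Real.log x)) = β / 512 - c := by
      field_simp
    have h5 := mul_le_mul_of_nonneg_left hsum hr.le
    rw [h4] at h3
    rw [mul_sub] at h5
    nlinarith
  constructor
  · refine le_of_forall_lt_imp_le_of_dense fun c hc => ?_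
    refine le_liminf_of_le ?_ (key c hc)
    refine IsBoundedUnder.isCoboundedUnder_ge ⟨Real.log 4 + 1, ?_⟩
    rw [eventually_map]
    filter_upwards [Chebyshev.eventually_primeCounting_le one_pos, eventually_gt_atTop 1]
      with x hx1 hx
    have hl : 0 < Real.log x := Real.log_pos hx
    have hx0 : 0 < x := by linarith
    have hcard : (((primesUpTo x).filter (fun p => u p * v p < 0)).card : ℝ) ≤
        Nat.primeCounting ⌊x⌋₊ := by
      have : (primesUpTo x).card = Nat.primeCounting ⌊x⌋₊ := by
        rw [Nat.primeCounting, Nat.primeCounting', Nat.count_eq_card_filter_range, primesUpTo]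
        congr 2
        ext a
        simp [Nat.lt_succ_iff]
      rw [← this]
      exact_mod_cast Finset.card_filter_le _ _
    calc _ ≤ Real.log x / x * ((Real.log 4 + 1) * x / Real.log x) := by
          gcongr
          exact hcard.trans hx1
      _ = _ := by field_simp
  · intro hfin
    have h1 := key (β / 1024) (by linarith)
    have h2 : Tendsto (fun x : ℝ => Real.log x / x * (hfin.toFinset.card : ℝ)) atTop (nhds 0) := by
      have := (Real.isLittleO_log_id_atTop.tendsto_div_nhds_zero).mul_const
        (hfin.toFinset.card : ℝ)
      simpa using this
    have h3 := h2.eventually_lt_const (show (0 : ℝ) < β / 1024 by positivity)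
    obtain ⟨x, h1, h3, hx⟩ := (h1.and (h3.and (eventually_gt_atTop 1))).exists
    have hl : 0 < Real.log x := Real.log_pos hx
    have hx0 : 0 < x := by linarith
    have hc : (((primesUpTo x).filter (fun p => u p * v p < 0)).card : ℝ) ≤
        hfin.toFinset.card := by
      have : (primesUpTo x).filter (fun p => u p * v p < 0) ⊆ hfin.toFinset := by
        intro p hp
        simp only [primesUpTo, Finset.mem_filter] at hp
        simpa using And.intro hp.1.2 hp.2
      exact_mod_cast Finset.card_le_card this
    have := mul_le_mul_of_nonneg_left hc (show 0 ≤ Real.log x / x by positivity)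
    linarith
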